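/- arXiv:1008.3769 — 3 statements merged into one kernel-verified Lean document; each statement's English description precedes it below -/
import Mathlib

section
/- For every N ≥ 3, every ψ ∈ [0, ψ*), every configuration η with η(x) ≥ 1, and every pair of nearest-neighbor sites x, y ∈ T_N^d, the detailed-balance identity ν̄_ψ({η}) · c(x,y,η) · g(η(x)) = ν̄_ψ({η^{x,y}}) · c(y,x,η^{x,y}) · g(η^{x,y}(y)) holds. Consequently the particle dynamics with these rates is reversible with respect to each product measure ν̄_ψ. -/
/-!
STATEMENT 0: Detailed balance for the degenerate rates with respect to the
product measures ν̄_ψ, ψ ∈ [0, ψ*).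
-/

open scoped BigOperators

/-- `g(k)! = g(1)⋯g(k)`, with `g(0)! = 1`. -/
noncomputable def gFact (g : ℕ → ℝ) (k : ℕ) : ℝ := ∏ j ∈ Finset.Icc 1 k, g j

/-- The partition function `Z(ψ) = Σ_k ψ^k / g(k)!`. -/
noncomputable def partZ (g : ℕ → ℝ) (ψ : ℝ) : ℝ := ∑' k : ℕ, ψ ^ k / gFact g k

/-- Distance on the discrete torus `(ℤ/Nℤ)^d` induced by the sum norm. -/
def torusDist {d N : ℕ} (x y : Fin d → ZMod N) : ℕ :=
  ∑ i, min (x i - y i).val (y i - x i).val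

/-- The exchange rate `c(x,y,η) = g(η(2x−y)) + g(η(2y−x))`. -/
noncomputable def rate {d N : ℕ} (g : ℕ → ℝ) (x y : Fin d → ZMod N)
    (η : (Fin d → ZMod N) → ℕ) : ℝ :=
  g (η (2 • x - y)) + g (η (2 • y - x))

/-- The configuration after a particle jumps from `x` to `y`. -/
def jump {d N : ℕ} (η : (Fin d → ZMod N) → ℕ) (x y : Fin d → ZMod N) :
    (Fin d → ZMod N) → ℕ :=
  Function.update (Function.update η x (η x - 1)) y (η y + 1)

/-- The weight of a single configuration `η` under the product measure `ν̄_ψ`. -/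
noncomputable def nuBarWeight {d N : ℕ} [NeZero N] (g : ℕ → ℝ) (ψ : ℝ)
    (η : (Fin d → ZMod N) → ℕ) : ℝ :=
  ∏ x : Fin d → ZMod N, ψ ^ (η x) / (partZ g ψ * gFact g (η x))

/-- Recursion for the single-site weights of `ν̄_ψ`. -/
lemma siteWeight_succ_mul {g : ℕ → ℝ} (hg_zero : ∀ k, g k = 0 ↔ k = 0) (ψ Z : ℝ) (k : ℕ) :
    ψ ^ (k + 1) / (Z * gFact g (k + 1)) * g (k + 1) = ψ * (ψ ^ k / (Z * gFact g k)) := by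
  have hg : g (k + 1) ≠ 0 := fun h => Nat.succ_ne_zero k ((hg_zero _).1 h)
  rw [gFact, Finset.prod_Icc_succ_top (by omega), ← gFact, ← mul_assoc Z, div_mul_eq_mul_div,
    mul_div_mul_right _ _ hg, pow_succ']
  ring

/-- On a torus of side at least three, sites at distance one do not satisfy `2x = 2y`. -/
lemma two_nsmul_ne_of_torusDist_eq_one {d N : ℕ} (hN : 3 ≤ N) {x y : Fin d → ZMod N}
    (hxy : torusDist x y = 1) : 2 • x ≠ 2 • y := by
  have : Fact (1 < N) := ⟨by omega⟩
  have htwo : (2 : ZMod N) ≠ 0 := by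
    intro h
    have h' : ((2 : ℕ) : ZMod N) = 0 := by exact_mod_cast h
    rw [ZMod.natCast_eq_zero_iff] at h'
    have := Nat.le_of_dvd (by norm_num) h'
    omega
  intro h
  obtain ⟨i, -, hi⟩ := Finset.exists_ne_zero_of_sum_ne_zero
    (show torusDist x y ≠ 0 by omega)
  have hle : min (x i - y i).val (y i - x i).val ≤ 1 := by
    rw [← hxy]
    exact Finset.single_le_sum (f := fun j => min (x j - y j).val (y j - x j).val)
      (fun _ _ => Nat.zero_le _) (Finset.mem_univ i)
  have hcoord : 2 * x i = 2 * y i := by simpa using congrFun h i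
  have hmin : (x i - y i).val = 1 ∨ (y i - x i).val = 1 := by omega
  have eq_one : ∀ a : ZMod N, a.val = 1 → a = 1 := fun a ha =>
    ZMod.val_injective N (by rw [ha, ZMod.val_one])
  rcases hmin with h1 | h1
  · exact htwo (by linear_combination hcoord - 2 * eq_one _ h1)
  · exact htwo (by linear_combination -hcoord - 2 * eq_one _ h1)

lemma jump_apply_of_ne {d N : ℕ} (η : (Fin d → ZMod N) → ℕ) {x y z : Fin d → ZMod N}
    (hzx : z ≠ x) (hzy : z ≠ y) : jump η x y z = η z := by
  simp [jump, hzx, hzy]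

/-- A jump across an edge leaves the exchange rate of that edge unchanged. -/
lemma rate_jump {d N : ℕ} (g : ℕ → ℝ) (η : (Fin d → ZMod N) → ℕ) {x y : Fin d → ZMod N}
    (h : 2 • x ≠ 2 • y) : rate g y x (jump η x y) = rate g x y η := by
  have hne : x ≠ y := fun e => h (by rw [e])
  have reflect_ne : ∀ {a b : Fin d → ZMod N}, a ≠ b → 2 • a - b ≠ a := fun hab e =>
    hab (by rw [two_nsmul, add_sub_assoc, add_eq_left, sub_eq_zero] at e; exact e)
  have reflect_ne' : ∀ {a b : Fin d → ZMod N}, 2 • a ≠ 2 • b → 2 • a - b ≠ b := fun hab e =>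
    hab (by rw [sub_eq_iff_eq_add] at e; rw [e, two_nsmul])
  rw [rate, rate, jump_apply_of_ne η (reflect_ne' h.symm) (reflect_ne hne.symm),
    jump_apply_of_ne η (reflect_ne hne) (reflect_ne' h), add_comm]

/-- The weight of a configuration, with the factors at two distinct sites split off. -/
lemma nuBarWeight_eq_mul_mul_prod {d N : ℕ} [NeZero N] (g : ℕ → ℝ) (ψ : ℝ)
    (η : (Fin d → ZMod N) → ℕ) {x y : Fin d → ZMod N} (hne : x ≠ y) :
    nuBarWeight g ψ η = ψ ^ η x / (partZ g ψ * gFact g (η x)) *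
      (ψ ^ η y / (partZ g ψ * gFact g (η y)) *
        ∏ z ∈ (Finset.univ.erase x).erase y, ψ ^ η z / (partZ g ψ * gFact g (η z))) := by
  rw [nuBarWeight, Finset.mul_prod_erase _ (fun z => ψ ^ η z / (partZ g ψ * gFact g (η z)))
      (Finset.mem_erase.2 ⟨hne.symm, Finset.mem_univ y⟩),
    Finset.mul_prod_erase _ (fun z => ψ ^ η z / (partZ g ψ * gFact g (η z))) (Finset.mem_univ x)]

theorem detailed_balance
    (d N : ℕ) [NeZero N] (hd : 1 ≤ d) (hN : 3 ≤ N)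
    (g : ℕ → ℝ) (hg_nonneg : ∀ k, 0 ≤ g k) (hg_zero : ∀ k, g k = 0 ↔ k = 0)
    (psiStar : ENNReal) (hpsiStar : 0 < psiStar)
    (hrad : ∀ ψ : ℝ, 0 ≤ ψ → ENNReal.ofReal ψ < psiStar →
      Summable (fun k : ℕ => ψ ^ k / gFact g k))
    (ψ : ℝ) (hψ0 : 0 ≤ ψ) (hψ : ENNReal.ofReal ψ < psiStar)
    (η : (Fin d → ZMod N) → ℕ) (x y : Fin d → ZMod N)
    (hxy : torusDist x y = 1) (hx : 1 ≤ η x) :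
    nuBarWeight g ψ η * rate g x y η * g (η x)
      = nuBarWeight g ψ (jump η x y) * rate g y x (jump η x y)
          * g (jump η x y y) := by
  have h2 := two_nsmul_ne_of_torusDist_eq_one hN hxy
  have hne : x ≠ y := fun e => h2 (by rw [e])
  have hrest : ∏ z ∈ (Finset.univ.erase x).erase y,
        ψ ^ jump η x y z / (partZ g ψ * gFact g (jump η x y z)) =
      ∏ z ∈ (Finset.univ.erase x).erase y, ψ ^ η z / (partZ g ψ * gFact g (η z)) := by
    refine Finset.prod_congr rfl fun z hz => ?_
    simp only [Finset.mem_erase] at hz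
    rw [jump_apply_of_ne η hz.2.1 hz.1]
  obtain ⟨m, hm⟩ := Nat.exists_eq_add_of_le' hx
  have hjx : jump η x y x = m := by simp [jump, hne, hm]
  have hjy : jump η x y y = η y + 1 := by simp [jump]
  rw [rate_jump g η h2, nuBarWeight_eq_mul_mul_prod g ψ η hne,
    nuBarWeight_eq_mul_mul_prod g ψ (jump η x y) hne, hrest, hjx, hjy, hm]
  have hmx := siteWeight_succ_mul hg_zero ψ (partZ g ψ) m
  have hmy := siteWeight_succ_mul hg_zero ψ (partZ g ψ) (η y)
  generalize ψ ^ (m + 1) / (partZ g ψ * gFact g (m + 1)) = p₁ at *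
  generalize ψ ^ (η y + 1) / (partZ g ψ * gFact g (η y + 1)) = q₁ at *
  generalize ψ ^ m / (partZ g ψ * gFact g m) = p₀ at *
  generalize ψ ^ η y / (partZ g ψ * gFact g (η y)) = q₀ at *
  generalize ∏ z ∈ (Finset.univ.erase x).erase y, ψ ^ η z / (partZ g ψ * gFact g (η z)) = R at *
  linear_combination q₀ * R * rate g x y η * hmx - p₀ * R * rate g x y η * hmy
end

section
/- Let η be a configuration on T_N^d such that for all distinct sites x, y with |x−y| ≤ 2 in the sum norm, η(x)·η(y) = 0 (no two sites at distance one or two are both occupied). Then c(x,y,η)·g(η(x)) = 0 for every pair of nearest-neighbor sites x, y; i.e., no jump is allowed from η, so η is a blocked configuration. In particular, for N ≥ 5 and k ≥ 1, the configuration with all k particles at a single site is blocked, and hence the hyperplane Σ_{N,k} = {η : Σ_x η(x) = k} is not irreducible: it contains configurations η and ξ such that ξ is not reachable from η. -/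
/-!
STATEMENT 4: Configurations with no two occupied sites at (torus sum-norm)
distance one or two are blocked; in particular for N ≥ 5 and k ≥ 1 the
configuration with all k particles at one site is blocked, and the hyperplane
Σ_{N,k} is not irreducible.
-/

open scoped BigOperators

/-- One allowed jump of the dynamics. -/
noncomputable def AllowedStep {d N : ℕ} (g : ℕ → ℝ)
    (η ξ : (Fin d → ZMod N) → ℕ) : Prop :=
  ∃ x y : Fin d → ZMod N, torusDist x y = 1 ∧
    0 < rate g x y η * g (η x) ∧ ξ = jump η x y

/-- `ξ` is reachable from `η` through allowed jumps. -/
noncomputable def Reachable {d N : ℕ} (g : ℕ → ℝ)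
    (η ξ : (Fin d → ZMod N) → ℕ) : Prop :=
  Relation.ReflTransGen (AllowedStep g) η ξ

theorem torusDist_self {d N : ℕ} (x : Fin d → ZMod N) : torusDist x x = 0 := by
  simp [torusDist]

theorem ne_of_torusDist_eq_one {d N : ℕ} {x y : Fin d → ZMod N} (h : torusDist x y = 1) :
    x ≠ y := by
  rintro rfl
  simp [torusDist_self] at h

theorem torusDist_two_smul_sub_left {d N : ℕ} (x y : Fin d → ZMod N) :
    torusDist x (2 • x - y) = torusDist x y := by
  unfold torusDist
  refine Finset.sum_congr rfl fun i _ => ?_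
  have h₁ : x i - (2 • x - y) i = y i - x i := by
    simp only [Pi.sub_apply, Pi.add_apply, two_smul]; ring
  have h₂ : (2 • x - y) i - x i = x i - y i := by
    simp only [Pi.sub_apply, Pi.add_apply, two_smul]; ring
  rw [h₁, h₂, min_comm]

theorem torusDist_two_smul_sub_right_le {d N : ℕ} [NeZero N] (x y : Fin d → ZMod N) :
    torusDist x (2 • y - x) ≤ 2 * torusDist x y := by
  unfold torusDist
  rw [Finset.mul_sum]
  refine Finset.sum_le_sum fun i _ => ?_
  have h₁ : x i - (2 • y - x) i = (x i - y i) + (x i - y i) := by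
    simp only [Pi.sub_apply, Pi.add_apply, two_smul]; ring
  have h₂ : (2 • y - x) i - x i = (y i - x i) + (y i - x i) := by
    simp only [Pi.sub_apply, Pi.add_apply, two_smul]; ring
  rw [h₁, h₂]
  have := ZMod.val_add_le (x i - y i) (x i - y i)
  have := ZMod.val_add_le (y i - x i) (y i - x i)
  omega

theorem ZMod.eq_zero_of_add_self_eq_zero_of_val_le_one {N : ℕ} [NeZero N] (hN : 3 ≤ N)
    {a : ZMod N} (h : a + a = 0) (ha : a.val ≤ 1) : a = 0 := by
  have h₁ := ZMod.val_add_of_lt (a := a) (b := a) (by omega)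
  rw [h, ZMod.val_zero] at h₁
  exact (ZMod.val_eq_zero a).1 (by omega)

theorem ne_two_smul_sub_of_torusDist_eq_one {d N : ℕ} [NeZero N] (hN : 3 ≤ N)
    {x y : Fin d → ZMod N} (h : torusDist x y = 1) : x ≠ 2 • y - x := by
  intro he
  refine ne_of_torusDist_eq_one h (funext fun i => ?_)
  have hi : min (x i - y i).val (y i - x i).val ≤ 1 :=
    h ▸ Finset.single_le_sum (f := fun i => min (x i - y i).val (y i - x i).val)
      (fun _ _ => Nat.zero_le _) (Finset.mem_univ i)
  have hxi : x i = y i + y i - x i := by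
    simpa only [Pi.sub_apply, Pi.add_apply, two_smul] using congrFun he i
  rcases min_le_iff.1 hi with hv | hv
  · exact sub_eq_zero.1 (ZMod.eq_zero_of_add_self_eq_zero_of_val_le_one hN
      (by linear_combination hxi) hv)
  · exact (sub_eq_zero.1 (ZMod.eq_zero_of_add_self_eq_zero_of_val_le_one hN
      (by linear_combination -hxi) hv)).symm

theorem rate_mul_eq_zero_of_sparse {d N : ℕ} [NeZero N] (hN : 3 ≤ N) {g : ℕ → ℝ}
    (hg : g 0 = 0) {η : (Fin d → ZMod N) → ℕ}
    (hη : ∀ x y : Fin d → ZMod N, x ≠ y → torusDist x y ≤ 2 → η x * η y = 0)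
    {x y : Fin d → ZMod N} (h : torusDist x y = 1) : rate g x y η * g (η x) = 0 := by
  rcases Nat.eq_zero_or_pos (η x) with hx | hx
  · rw [hx, hg, mul_zero]
  have vacant {z : Fin d → ZMod N} (hz : x ≠ z) (hd : torusDist x z ≤ 2) : η z = 0 :=
    (Nat.mul_eq_zero.1 (hη x z hz hd)).resolve_left hx.ne'
  have hl : torusDist x (2 • x - y) = 1 := (torusDist_two_smul_sub_left x y).trans h
  have hr := torusDist_two_smul_sub_right_le x y
  rw [rate, vacant (ne_of_torusDist_eq_one hl) (by omega),
    vacant (ne_two_smul_sub_of_torusDist_eq_one hN h) (by omega), hg, add_zero, zero_mul]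

theorem eq_of_reachable_of_blocked {d N : ℕ} {g : ℕ → ℝ} {η ξ : (Fin d → ZMod N) → ℕ}
    (hη : ∀ x y : Fin d → ZMod N, torusDist x y = 1 → rate g x y η * g (η x) = 0)
    (h : Reachable g η ξ) : η = ξ := by
  rcases Relation.ReflTransGen.cases_head h with h | ⟨_, ⟨x, y, hxy, hpos, _⟩, _⟩
  · exact h
  · exact absurd (hη x y hxy) hpos.ne'

theorem blocked_configurations
    (d N : ℕ) [NeZero N] (hd : 1 ≤ d) (hN : 5 ≤ N)
    (g : ℕ → ℝ) (hg_nonneg : ∀ k, 0 ≤ g k) (hg_zero : ∀ k, g k = 0 ↔ k = 0)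
    (k : ℕ) (hk : 1 ≤ k) :
    -- any configuration with no two occupied sites at distance ≤ 2 is blocked
    (∀ η : (Fin d → ZMod N) → ℕ,
      (∀ x y : Fin d → ZMod N, x ≠ y → torusDist x y ≤ 2 → η x * η y = 0) →
      ∀ x y : Fin d → ZMod N, torusDist x y = 1 → rate g x y η * g (η x) = 0) ∧
    -- the configuration with all k particles at a single site is blocked
    (∀ x₀ : Fin d → ZMod N,
      ∀ x y : Fin d → ZMod N, torusDist x y = 1 →
        rate g x y (fun z => if z = x₀ then k else 0)
          * g ((fun z => if z = x₀ then k else 0) x) = 0) ∧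
    -- hence the hyperplane Σ_{N,k} is not irreducible
    (∃ η ξ : (Fin d → ZMod N) → ℕ,
      (∑ x : Fin d → ZMod N, η x) = k ∧ (∑ x : Fin d → ZMod N, ξ x) = k ∧
      ¬ Reachable g η ξ) := by
  have blocked : ∀ η : (Fin d → ZMod N) → ℕ,
      (∀ x y : Fin d → ZMod N, x ≠ y → torusDist x y ≤ 2 → η x * η y = 0) →
      ∀ x y : Fin d → ZMod N, torusDist x y = 1 → rate g x y η * g (η x) = 0 :=
    fun η hη x y h => rate_mul_eq_zero_of_sparse (by omega) ((hg_zero 0).2 rfl) hη h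
  have single : ∀ x₀ x y : Fin d → ZMod N, torusDist x y = 1 →
      rate g x y (fun z => if z = x₀ then k else 0)
        * g ((fun z => if z = x₀ then k else 0) x) = 0 := by
    refine fun x₀ => blocked _ fun x y hxy _ => ?_
    by_cases hx : x = x₀
    · simp [show y ≠ x₀ from fun hy => hxy (hx.trans hy.symm)]
    · simp [hx]
  refine ⟨blocked, single, fun z => if z = 0 then k else 0, fun z => if z = 1 then k else 0,
    by simp, by simp, fun h => ?_⟩
  have : Fact (1 < N) := ⟨by omega⟩
  have : Nonempty (Fin d) := ⟨⟨0, hd⟩⟩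
  have h₀ := congrFun (eq_of_reachable_of_blocked (single 0) h) 0
  simp only [if_true, zero_ne_one, if_false] at h₀
  omega
end

section
/- For every 0 < K₁ < K₂ < ∞ there exists a finite constant C such that |M(λ,β)| ≤ C·J_β(λ) for all β ∈ [K₁,K₂] and all λ ≥ 0. In particular, sup over β ∈ [K₁,K₂] and λ ≥ 0 of |M(λ,β)|/J_β(λ) is finite. -/
/-!
STATEMENT 14: For 0 < K₁ < K₂ < ∞, sup_{β ∈ [K₁,K₂], λ ≥ 0} |M(λ,β)|/J_β(λ) < ∞,
i.e. there is a finite C with |M(λ,β)| ≤ C·J_β(λ).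
-/

open scoped BigOperators

/-- The mean particle number per site `R(ψ)` under `ν̄_ψ`. -/
noncomputable def meanR (g : ℕ → ℝ) (ψ : ℝ) : ℝ :=
  ∑' k : ℕ, (k : ℝ) * ψ ^ k / (partZ g ψ * gFact g k)

/-- `M(λ,β) = p̃(λ) − p̃(β) − p̃′(β)(λ−β)` with `p̃ = Φ²`, `p̃′ = 2ΦΦ′`. -/
noncomputable def Mfun (Φ Φ' : ℝ → ℝ) (lam β : ℝ) : ℝ :=
  (Φ lam) ^ 2 - (Φ β) ^ 2 - 2 * Φ β * Φ' β * (lam - β)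

/-- The rate function `J_β(λ) = λ·log(Φ(λ)/Φ(β)) − log(Z(Φ(λ))/Z(Φ(β)))`
(with the convention `0·log 0 = 0`, which holds since `Real.log 0 = 0`). -/
noncomputable def Jfun (g : ℕ → ℝ) (Φ : ℝ → ℝ) (β lam : ℝ) : ℝ :=
  lam * Real.log (Φ lam / Φ β) - Real.log (partZ g (Φ lam) / partZ g (Φ β))

theorem summable_nat_mul_abs_mul_pow {a : ℕ → ℝ} {r s : ℝ} (hr : 0 ≤ r) (hrs : r < s)
    (h : Summable fun k : ℕ => a k * s ^ k) :
    Summable fun k : ℕ => (k : ℝ) * (|a k| * r ^ k) := by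
  have hs : 0 < s := hr.trans_lt hrs
  obtain ⟨C, hC⟩ := h.abs.tendsto_atTop_zero.bddAbove_range
  have hgeo : Summable fun k : ℕ => C * ((k : ℝ) ^ 1 * (r / s) ^ k) := by
    refine (summable_pow_mul_geometric_of_norm_lt_one 1 ?_).mul_left C
    rw [Real.norm_of_nonneg (by positivity)]
    exact (div_lt_one hs).2 hrs
  refine hgeo.of_nonneg_of_le (fun k => by positivity) fun k => ?_
  have hk : |a k| * s ^ k ≤ C := by
    have := hC ⟨k, rfl⟩
    simpa [abs_mul, abs_of_pos hs] using this
  calc (k : ℝ) * (|a k| * r ^ k) = (|a k| * s ^ k) * ((k : ℝ) ^ 1 * (r / s) ^ k) := by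
        rw [div_pow]; field_simp
    _ ≤ C * ((k : ℝ) ^ 1 * (r / s) ^ k) := by gcongr

theorem hasDerivAt_tsum_mul_pow {a : ℕ → ℝ} {x s : ℝ} (hx : |x| < s)
    (h : Summable fun k : ℕ => a k * s ^ k) :
    HasDerivAt (fun y => ∑' k : ℕ, a k * y ^ k)
      (∑' k : ℕ, a k * ((k : ℝ) * x ^ (k - 1))) x := by
  obtain ⟨r, hxr, hrs⟩ := exists_between hx
  have hr : 0 < r := (abs_nonneg x).trans_lt hxr
  have hu : Summable fun k : ℕ => |a k| * ((k : ℝ) * r ^ (k - 1)) := by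
    refine ((summable_nat_mul_abs_mul_pow hr.le hrs h).mul_left r⁻¹).congr fun k => ?_
    rcases k with _ | k
    · simp
    · simp only [Nat.add_sub_cancel, pow_succ]; field_simp
  refine hasDerivAt_tsum_of_isPreconnected (t := Metric.ball 0 r) (y₀ := 0) hu Metric.isOpen_ball
    (convex_ball (0 : ℝ) r).isPreconnected
    (fun k y _ => (hasDerivAt_pow k y).const_mul (a k)) (fun k y hy => ?_)
    (Metric.mem_ball_self hr) ?_ (by simpa using hxr)
  · have hy' : |y| ≤ r := by simpa using (mem_ball_zero_iff.1 hy).le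
    rw [Real.norm_eq_abs, abs_mul, abs_mul, abs_pow, Nat.abs_cast]
    gcongr
  · exact summable_of_ne_finset_zero (s := {0}) fun k hk => by
      simp [Finset.mem_singleton] at hk; simp [hk]

theorem analyticAt_tsum_mul_pow {a : ℕ → ℝ} {x s : ℝ} (hx : |x| < s)
    (h : Summable fun k : ℕ => a k * s ^ k) :
    AnalyticAt ℝ (fun y => ∑' k : ℕ, a k * y ^ k) x := by
  have hs : 0 < s := (abs_nonneg x).trans_lt hx
  lift s to NNReal using hs.le
  have hrad : (s : ENNReal) ≤ (FormalMultilinearSeries.ofScalars ℝ a).radius := by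
    refine FormalMultilinearSeries.le_radius_of_summable_norm _ (h.abs.congr fun k => ?_)
    simp [abs_mul]
  have hball := (FormalMultilinearSeries.ofScalars ℝ a).hasFPowerSeriesOnBall
    (lt_of_lt_of_le (by simpa using hs) hrad)
  have hmem : x ∈ Metric.eball (0 : ℝ) (FormalMultilinearSeries.ofScalars ℝ a).radius := by
    refine Metric.eball_subset_eball hrad ?_
    rw [Metric.eball_coe]
    simpa using hx
  convert hball.analyticAt_of_mem hmem using 1
  ext y
  simp [FormalMultilinearSeries.sum, mul_comm]

section PartitionFunction

variable {g : ℕ → ℝ}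

theorem gFact_pos (hg : ∀ k, k ≠ 0 → 0 < g k) (k : ℕ) : 0 < gFact g k :=
  Finset.prod_pos fun j hj => hg j (by have := (Finset.mem_Icc.1 hj).1; omega)

theorem gFact_succ (g : ℕ → ℝ) (k : ℕ) : gFact g (k + 1) = gFact g k * g (k + 1) :=
  Finset.prod_Icc_succ_top (by omega) _

theorem partZ_eq (g : ℕ → ℝ) : partZ g = fun ψ => ∑' k : ℕ, (gFact g k)⁻¹ * ψ ^ k := by
  ext ψ
  exact tsum_congr fun k => by rw [div_eq_inv_mul]

theorem one_add_div_le_partZ (hg : ∀ k, k ≠ 0 → 0 < g k) {ψ : ℝ} (hψ : 0 ≤ ψ)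
    (h : Summable fun k : ℕ => ψ ^ k / gFact g k) : 1 + ψ / g 1 ≤ partZ g ψ := by
  have := h.sum_le_tsum (Finset.range 2)
    fun k _ => div_nonneg (pow_nonneg hψ k) (gFact_pos hg k).le
  simpa [Finset.sum_range_succ, gFact, partZ] using this

theorem partZ_pos (hg : ∀ k, k ≠ 0 → 0 < g k) {ψ : ℝ} (hψ : 0 ≤ ψ)
    (h : Summable fun k : ℕ => ψ ^ k / gFact g k) : 0 < partZ g ψ :=
  lt_of_lt_of_le (by have := hg 1 one_ne_zero; positivity) (one_add_div_le_partZ hg hψ h)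

theorem meanR_eq (g : ℕ → ℝ) (ψ : ℝ) :
    meanR g ψ = (∑' k : ℕ, (k : ℝ) * (ψ ^ k / gFact g k)) / partZ g ψ := by
  rw [meanR, ← tsum_div_const]
  exact tsum_congr fun k => by rw [mul_comm (partZ g ψ), mul_div_assoc, ← div_div, mul_div_assoc]

theorem summable_nat_mul_weight (hg : ∀ k, k ≠ 0 → 0 < g k) {ψ s : ℝ} (hψ : 0 ≤ ψ) (hs : ψ < s)
    (h : Summable fun k : ℕ => s ^ k / gFact g k) :
    Summable fun k : ℕ => (k : ℝ) * (ψ ^ k / gFact g k) := by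
  refine (summable_nat_mul_abs_mul_pow (a := fun k => (gFact g k)⁻¹) hψ hs
    (by simpa only [div_eq_inv_mul] using h)).congr fun k => ?_
  rw [abs_of_pos (inv_pos.2 (gFact_pos hg k)), div_eq_inv_mul]

theorem analyticAt_partZ {ψ s : ℝ} (hψ : |ψ| < s)
    (h : Summable fun k : ℕ => s ^ k / gFact g k) : AnalyticAt ℝ (partZ g) ψ := by
  rw [partZ_eq]
  exact analyticAt_tsum_mul_pow hψ (by simpa only [div_eq_inv_mul] using h)

theorem meanR_eq_mul_deriv_partZ {ψ s : ℝ} (hψ : |ψ| < s)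
    (h : Summable fun k : ℕ => s ^ k / gFact g k) :
    meanR g ψ = ψ * deriv (partZ g) ψ / partZ g ψ := by
  have hd := (hasDerivAt_tsum_mul_pow (a := fun k => (gFact g k)⁻¹) hψ
    (by simpa only [div_eq_inv_mul] using h)).deriv
  rw [← partZ_eq] at hd
  rw [meanR_eq, hd, ← tsum_mul_left]
  congr 1
  refine tsum_congr fun k => ?_
  rcases k with _ | k
  · simp
  · simp only [Nat.add_sub_cancel, pow_succ]; ring

theorem analyticAt_meanR (hg : ∀ k, k ≠ 0 → 0 < g k) {ψ s : ℝ} (hψ : 0 < ψ) (hs : ψ < s)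
    (h : Summable fun k : ℕ => s ^ k / gFact g k) : AnalyticAt ℝ (meanR g) ψ := by
  have hψs : |ψ| < s := by rwa [abs_of_pos hψ]
  have hZ := analyticAt_partZ hψs h
  have hsum : Summable fun k : ℕ => ψ ^ k / gFact g k :=
    h.of_nonneg_of_le (fun k => div_nonneg (pow_nonneg hψ.le k) (gFact_pos hg k).le)
      fun k => by have := (gFact_pos hg k).le; gcongr
  refine ((analyticAt_id.mul hZ.deriv).div hZ (partZ_pos hg hψ.le hsum).ne').congr ?_
  filter_upwards [(isOpen_lt continuous_abs continuous_const).mem_nhds hψs] with y hy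
  exact (meanR_eq_mul_deriv_partZ hy h).symm

/-- The single-site mean of `g` is `ψ`, so its square is at most the mean of `g ^ 2`. -/
theorem sq_le_mul_meanR (hg : ∀ k, k ≠ 0 → 0 < g k) (hg0 : g 0 = 0) {b : ℝ}
    (hG : ∀ k : ℕ, g k ^ 2 ≤ b * k) {ψ s : ℝ} (hψ : 0 ≤ ψ) (hs : ψ < s)
    (h : Summable fun k : ℕ => s ^ k / gFact g k) : ψ ^ 2 ≤ b * meanR g ψ := by
  have hw : ∀ k, 0 ≤ ψ ^ k / gFact g k := fun k =>
    div_nonneg (pow_nonneg hψ k) (gFact_pos hg k).le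
  have hsum : Summable fun k : ℕ => ψ ^ k / gFact g k :=
    h.of_nonneg_of_le hw fun k => by have := (gFact_pos hg k).le; gcongr
  have hsumk := summable_nat_mul_weight hg hψ hs h
  have hZ := partZ_pos hg hψ hsum
  have hmean : HasSum (fun k : ℕ => g k * (ψ ^ k / gFact g k)) (ψ * partZ g ψ) := by
    rw [← hasSum_nat_add_iff' 1]
    simp only [Finset.range_one, Finset.sum_singleton, hg0, zero_mul, sub_zero]
    refine (hsum.hasSum.mul_left ψ).congr_fun fun k => ?_
    have h1 := (hg (k + 1) k.succ_ne_zero).ne'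
    have h2 := (gFact_pos hg k).ne'
    rw [gFact_succ, pow_succ]; field_simp
  have hle := hasSum_le (fun k => ?_) (hmean.mul_left (2 * ψ))
    ((hsum.hasSum.mul_left (ψ ^ 2)).add (hsumk.hasSum.mul_left b))
  · rw [meanR_eq, ← mul_div_assoc, le_div_iff₀ hZ]
    change _ ≤ ψ ^ 2 * partZ g ψ + _ at hle
    nlinarith
  · nlinarith [mul_nonneg (sq_nonneg (ψ - g k)) (hw k), mul_le_mul_of_nonneg_right (hG k) (hw k)]

end PartitionFunction

/-- Second order Taylor lower bound for a function with second derivative at least `m`. -/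
theorem half_mul_sq_le_sub_of_le_deriv2 {S : Set ℝ} (hS : Convex ℝ S) {f f' f'' : ℝ → ℝ} {m : ℝ}
    (hf : ∀ x ∈ S, HasDerivAt f (f' x) x) (hf' : ∀ x ∈ S, HasDerivAt f' (f'' x) x)
    (hm : ∀ x ∈ S, m ≤ f'' x) {x y : ℝ} (hx : x ∈ S) (hy : y ∈ S) :
    m / 2 * (y - x) ^ 2 ≤ f y - f x - f' x * (y - x) := by
  have hd : ∀ z ∈ S, HasDerivAt (fun z => f z - m / 2 * z ^ 2) (f' z - m * z) z := fun z hz => by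
    refine ((hf z hz).sub ((hasDerivAt_pow 2 z).const_mul (m / 2))).congr_deriv ?_
    norm_num; ring
  have hd' : ∀ z ∈ S, HasDerivAt (fun z => f' z - m * z) (f'' z - m) z := fun z hz => by
    exact ((hf' z hz).sub ((hasDerivAt_id z).const_mul m)).congr_deriv (by rw [mul_one])
  have hc : ConvexOn ℝ S fun z => f z - m / 2 * z ^ 2 :=
    convexOn_of_hasDerivWithinAt2_nonneg hS
      (fun z hz => (hd z hz).continuousAt.continuousWithinAt)
      (fun z hz => (hd z (interior_subset hz)).hasDerivWithinAt)
      (fun z hz => (hd' z (interior_subset hz)).hasDerivWithinAt)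
      fun z hz => sub_nonneg.2 (hm z (interior_subset hz))
  rcases lt_trichotomy x y with h | rfl | h
  · have := hc.le_slope_of_hasDerivAt hx hy h (hd x hx)
    rw [slope_def_field, le_div_iff₀ (sub_pos.2 h)] at this
    linarith
  · simp
  · have := hc.slope_le_of_hasDerivAt hy hx h (hd x hx)
    rw [slope_def_field, div_le_iff₀ (sub_pos.2 h)] at this
    linarith

/-- The derivative of a differentiable right inverse of an analytic function is
continuously differentiable. -/
theorem exists_continuousOn_hasDerivAt_of_analyticAt {F Φ Φ' : ℝ → ℝ} {U : Set ℝ} (hU : IsOpen U)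
    (hF : ∀ α ∈ U, AnalyticAt ℝ F (Φ α)) (hinv : ∀ α ∈ U, F (Φ α) = α)
    (hΦ : ∀ α ∈ U, HasDerivAt Φ (Φ' α) α) :
    ∃ Φ'' : ℝ → ℝ, ContinuousOn Φ'' U ∧ ∀ α ∈ U, HasDerivAt Φ' (Φ'' α) α := by
  have hmul : ∀ α ∈ U, deriv F (Φ α) * Φ' α = 1 := fun α hα => by
    have h1 : HasDerivAt (F ∘ Φ) (deriv F (Φ α) * Φ' α) α :=
      (hF α hα).differentiableAt.hasDerivAt.comp α (hΦ α hα)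
    refine h1.unique ((hasDerivAt_id α).congr_of_eventuallyEq ?_)
    filter_upwards [hU.mem_nhds hα] with x hx using hinv x hx
  have hne : ∀ α ∈ U, deriv F (Φ α) ≠ 0 := fun α hα => left_ne_zero_of_mul_eq_one (hmul α hα)
  have heq : ∀ α ∈ U, Φ' α = (deriv F (Φ α))⁻¹ := fun α hα => eq_inv_of_mul_eq_one_right (hmul α hα)
  have hder : ∀ α ∈ U, HasDerivAt (fun x => deriv F (Φ x)) (deriv (deriv F) (Φ α) * Φ' α) α :=
    fun α hα => (hF α hα).deriv.differentiableAt.hasDerivAt.comp α (hΦ α hα)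
  have hder' : ∀ α ∈ U, HasDerivAt Φ'
      (-(deriv (deriv F) (Φ α) * Φ' α) / deriv F (Φ α) ^ 2) α := fun α hα => by
    refine ((hder α hα).inv (hne α hα)).congr_of_eventuallyEq ?_
    filter_upwards [hU.mem_nhds hα] with x hx using heq x hx
  refine ⟨_, fun α hα => ContinuousAt.continuousWithinAt ?_, hder'⟩
  have h2 : ContinuousAt (fun x => deriv (deriv F) (Φ x)) α :=
    ContinuousAt.comp (hF α hα).deriv.deriv.continuousAt (hΦ α hα).continuousAt
  exact ((h2.mul (hder' α hα).continuousAt).neg).div ((hder α hα).continuousAt.pow 2)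
    (pow_ne_zero 2 (hne α hα))

/-- Differentiating in the density, the derivative of `log Z (Φ λ)` cancels that of the factor
`log (Φ λ)`, because `R (Φ λ) = λ`. -/
theorem hasDerivAt_Jfun {g : ℕ → ℝ} {Φ : ℝ → ℝ} {v β l : ℝ} (hβ : 0 < Φ β) (hl : 0 < Φ l)
    (hZβ : 0 < partZ g (Φ β)) (hZl : 0 < partZ g (Φ l))
    (hZ : DifferentiableAt ℝ (partZ g) (Φ l))
    (hR : Φ l * deriv (partZ g) (Φ l) / partZ g (Φ l) = l) (hΦ : HasDerivAt Φ v l) :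
    HasDerivAt (Jfun g Φ β) (Real.log (Φ l) - Real.log (Φ β)) l := by
  have hZΦ : HasDerivAt (fun x => partZ g (Φ x)) (deriv (partZ g) (Φ l) * v) l :=
    hZ.hasDerivAt.comp l hΦ
  have h1 := ((hasDerivAt_id l).mul ((hΦ.div_const (Φ β)).log (div_pos hl hβ).ne')).sub
    ((hZΦ.div_const (partZ g (Φ β))).log (div_pos hZl hZβ).ne')
  refine h1.congr_deriv ?_
  rw [id, Real.log_div hl.ne' hβ.ne']
  field_simp at hR ⊢
  linear_combination -v * hR

/-- Combines a quadratic comparison of `M` and `J` on `[a, N]` with a uniform lower bound on `J`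
below `a` and linear bounds above `N`. -/
theorem abs_le_mul_of_three_regimes {M J lam β a N L m c d A : ℝ} (hm : 0 < m) (hc : 0 < c)
    (hd : 0 < d) (hL : 0 ≤ L) (hA : 0 ≤ A) (ha : 0 ≤ a) (hlam : 0 ≤ lam)
    (hlow : lam < a → c ≤ J)
    (hmid : a ≤ lam → lam ≤ N → |M| ≤ L * (lam - β) ^ 2 ∧ m * (lam - β) ^ 2 ≤ J)
    (hhigh : N < lam → d * (1 + lam) ≤ J) (hM : |M| ≤ A * (1 + lam)) :
    |M| ≤ (L / m + A * (1 + a) / c + A / d) * J := by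
  have key : ∀ {x}, 0 ≤ J → |M| ≤ x * J → x ≤ L / m + A * (1 + a) / c + A / d →
      |M| ≤ (L / m + A * (1 + a) / c + A / d) * J :=
    fun hJ h hx => h.trans (mul_le_mul_of_nonneg_right hx hJ)
  have h1 : 0 ≤ L / m := by positivity
  have h2 : 0 ≤ A * (1 + a) / c := by positivity
  have h3 : 0 ≤ A / d := by positivity
  rcases lt_or_ge lam a with h | h
  · have hJ := hlow h
    refine key (x := A * (1 + a) / c) (hc.le.trans hJ) ?_ (by linarith)
    calc |M| ≤ A * (1 + lam) := hM
      _ ≤ A * (1 + a) := by gcongr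
      _ = A * (1 + a) / c * c := by field_simp
      _ ≤ _ := by gcongr
  rcases le_or_gt lam N with h' | h'
  · obtain ⟨hMl, hJ⟩ := hmid h h'
    refine key (x := L / m) ((by positivity : (0 : ℝ) ≤ _).trans hJ) ?_ (by linarith)
    calc |M| ≤ L * (lam - β) ^ 2 := hMl
      _ = L / m * (m * (lam - β) ^ 2) := by field_simp
      _ ≤ _ := by gcongr
  · have hJ := hhigh h'
    refine key (x := A / d) ((by positivity : (0 : ℝ) ≤ _).trans hJ) ?_ (by linarith)
    calc |M| ≤ A * (1 + lam) := hM
      _ = A / d * (d * (1 + lam)) := by field_simp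
      _ ≤ _ := by gcongr

theorem M_J_ratio_bounded
    (g : ℕ → ℝ) (hg_nonneg : ∀ k, 0 ≤ g k) (hg_zero : ∀ k, g k = 0 ↔ k = 0)
    (b : ℝ) (hb : 0 < b) (hG : ∀ k : ℕ, g k ^ 2 ≤ b * k)
    (psiStar : ENNReal) (hpsiStar : 0 < psiStar)
    (hrad : ∀ ψ : ℝ, 0 ≤ ψ → ENNReal.ofReal ψ < psiStar →
      Summable (fun k : ℕ => ψ ^ k / gFact g k))
    (hZinf : ∀ s : ℝ, ENNReal.ofReal s = psiStar →
      Filter.Tendsto (partZ g) (nhdsWithin s (Set.Iio s)) Filter.atTop)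
    (Φ Φ' : ℝ → ℝ) (hΦ0 : Φ 0 = 0)
    (hΦ_range : ∀ α : ℝ, 0 ≤ α → 0 ≤ Φ α ∧ ENNReal.ofReal (Φ α) < psiStar)
    (hΦ_inv : ∀ α : ℝ, 0 ≤ α → meanR g (Φ α) = α)
    (hΦ_deriv : ∀ α : ℝ, 0 ≤ α → HasDerivAt Φ (Φ' α) α ∧ 0 < Φ' α)
    (hΦ'_cont : ContinuousOn Φ' (Set.Ici 0))
    (K₁ K₂ : ℝ) (hK₁ : 0 < K₁) (hK : K₁ < K₂) :
    ∃ C : ℝ, ∀ β ∈ Set.Icc K₁ K₂, ∀ lam : ℝ, 0 ≤ lam →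
      |Mfun Φ Φ' lam β| ≤ C * Jfun g Φ β lam := by
  have hg : ∀ k, k ≠ 0 → 0 < g k := fun k hk =>
    (hg_nonneg k).lt_of_ne fun h => hk ((hg_zero k).1 h.symm)
  have hsum : ∀ α, 0 ≤ α → Summable fun k : ℕ => Φ α ^ k / gFact g k := fun α hα =>
    hrad _ (hΦ_range α hα).1 (hΦ_range α hα).2
  have hbig : ∀ α, 0 ≤ α → ∃ s, Φ α < s ∧ Summable fun k : ℕ => s ^ k / gFact g k := by
    intro α hα
    obtain ⟨s, hs0, hs1, hs2⟩ := ENNReal.lt_iff_exists_real_btwn.1 (hΦ_range α hα).2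
    exact ⟨s, (ENNReal.ofReal_lt_ofReal_iff_of_nonneg (hΦ_range α hα).1).1 hs1, hrad s hs0 hs2⟩
  have hZpos : ∀ α, 0 ≤ α → 0 < partZ g (Φ α) := fun α hα =>
    partZ_pos hg (hΦ_range α hα).1 (hsum α hα)
  have hmono : StrictMonoOn Φ (Set.Ici 0) := by
    refine strictMonoOn_of_deriv_pos (convex_Ici 0)
      (fun α hα => (hΦ_deriv α hα).1.continuousAt.continuousWithinAt) fun α hα => ?_
    have h := hΦ_deriv α (interior_subset hα)
    rw [h.1.deriv]
    exact h.2
  have hpos : ∀ α, 0 < α → 0 < Φ α := fun α hα =>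
    hΦ0 ▸ hmono Set.self_mem_Ici hα.le hα
  have hsq : ∀ α, 0 ≤ α → Φ α ^ 2 ≤ b * α := fun α hα => by
    obtain ⟨s, hs, hss⟩ := hbig α hα
    simpa only [hΦ_inv α hα] using
      sq_le_mul_meanR hg ((hg_zero 0).2 rfl) hG (hΦ_range α hα).1 hs hss
  obtain ⟨Φ'', hΦ''c, hΦ''⟩ := exists_continuousOn_hasDerivAt_of_analyticAt (F := meanR g)
    (Φ := Φ) (Φ' := Φ') (isOpen_Ioi (a := (0 : ℝ)))
    (fun α hα => by
      obtain ⟨s, hs, hss⟩ := hbig α (le_of_lt hα)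
      exact analyticAt_meanR hg (hpos α hα) hs hss)
    (fun α hα => hΦ_inv α (le_of_lt hα)) fun α hα => (hΦ_deriv α (le_of_lt hα)).1
  have hJ' : ∀ β, 0 < β → ∀ l ∈ Set.Ioi (0 : ℝ),
      HasDerivAt (Jfun g Φ β) (Real.log (Φ l) - Real.log (Φ β)) l := by
    intro β hβ l hl
    have hl0 : 0 ≤ l := le_of_lt hl
    obtain ⟨s, hs, hss⟩ := hbig l hl0
    have hs' : |Φ l| < s := by rwa [abs_of_pos (hpos l hl)]
    exact hasDerivAt_Jfun (hpos β hβ) (hpos l hl) (hZpos β hβ.le) (hZpos l hl0)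
      (analyticAt_partZ hs' hss).differentiableAt
      (by rw [← meanR_eq_mul_deriv_partZ hs' hss, hΦ_inv l hl0]) (hΦ_deriv l hl0).1
  have hJ'' : ∀ β, ∀ l ∈ Set.Ioi (0 : ℝ),
      HasDerivAt (fun l => Real.log (Φ l) - Real.log (Φ β)) (Φ' l / Φ l) l := fun β l hl =>
    ((hΦ_deriv l (le_of_lt hl)).1.log (hpos l hl).ne').sub_const _
  have hJβ : ∀ β, 0 < β → Jfun g Φ β β = 0 := fun β hβ => by
    simp [Jfun, (hpos β hβ).ne', (hZpos β hβ.le).ne']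
  have hJ_tangent : ∀ β, 0 < β → ∀ l, 0 < l → ∀ x, 0 < x →
      (Real.log (Φ x) - Real.log (Φ β)) * (l - x) ≤ Jfun g Φ β l - Jfun g Φ β x := by
    intro β hβ l hl x hx
    have := half_mul_sq_le_sub_of_le_deriv2 (convex_Ioi (0 : ℝ)) (hJ' β hβ) (hJ'' β) (m := 0)
      (fun l hl => (div_pos (hΦ_deriv l (le_of_lt hl)).2 (hpos l hl)).le) hx hl
    linarith
  obtain ⟨a, ha, haK⟩ : ∃ a, 0 < a ∧ a < K₁ := exists_between hK₁
  set N := K₂ + 1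
  have hsub : Set.Icc a N ⊆ Set.Ioi 0 := fun x hx => ha.trans_le hx.1
  have hne : (Set.Icc a N).Nonempty := Set.nonempty_Icc.2 (by linarith)
  have hΦc : ContinuousOn Φ (Set.Icc a N) := fun x hx =>
    (hΦ_deriv x (hsub hx).le).1.continuousAt.continuousWithinAt
  have hΦ'c : ContinuousOn Φ' (Set.Icc a N) := hΦ'_cont.mono (hsub.trans Set.Ioi_subset_Ici_self)
  obtain ⟨m, hm, hmle⟩ : ∃ m, 0 < m ∧ ∀ x ∈ Set.Icc a N, m ≤ Φ' x / Φ x := by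
    obtain ⟨x, hx, hmin⟩ := isCompact_Icc.exists_isMinOn hne
      (hΦ'c.div hΦc fun x hx => (hpos x (hsub hx)).ne')
    exact ⟨_, div_pos (hΦ_deriv x (hsub hx).le).2 (hpos x (hsub hx)), fun y hy => hmin hy⟩
  obtain ⟨B, hB⟩ := isCompact_Icc.exists_bound_of_continuousOn
    ((continuousOn_const (c := (2 : ℝ))).mul hΦc |>.mul hΦ'c)
  obtain ⟨L, hL⟩ := isCompact_Icc.exists_bound_of_continuousOn
    (((continuousOn_const (c := (2 : ℝ))).mul hΦ'c |>.mul hΦ'c).add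
      ((continuousOn_const (c := (2 : ℝ))).mul hΦc |>.mul (hΦ''c.mono hsub)))
  have hB0 : 0 ≤ B := (norm_nonneg _).trans (hB _ hne.some_mem)
  have hL0 : 0 ≤ L := (norm_nonneg _).trans (hL _ hne.some_mem)
  have hp' : ∀ x ∈ Set.Icc a N, HasDerivAt (fun x => Φ x ^ 2) (2 * Φ x * Φ' x) x := fun x hx => by
    exact ((hΦ_deriv x (hsub hx).le).1.pow 2).congr_deriv (by simp)
  have hp'' : ∀ x ∈ Set.Icc a N, HasDerivAt (fun x => 2 * Φ x * Φ' x)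
      (2 * Φ' x * Φ' x + 2 * Φ x * Φ'' x) x := fun x hx =>
    ((hΦ_deriv x (hsub hx).le).1.const_mul 2).mul (hΦ'' x (hsub hx))
  set c := min (m / 2 * (K₁ - a) ^ 2) (Real.log (1 + Φ K₁ / g 1))
  set δ := Real.log (Φ N) - Real.log (Φ K₂)
  set d := min (m / 2 / (1 + N)) δ
  have hK₂ : 0 < K₂ := hK₁.trans hK
  have hN0 : 0 < N := by linarith
  have hδ0 : 0 < δ := sub_pos.2
    (Real.log_lt_log (hpos K₂ hK₂) (hmono hK₂.le hN0.le (by linarith)))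
  have hd0 : 0 < d := lt_min (by positivity) hδ0
  have hc0 : 0 < c := by
    refine lt_min ?_ (Real.log_pos ?_)
    · have : 0 < K₁ - a := by linarith
      positivity
    · have := div_pos (hpos K₁ hK₁) (hg 1 one_ne_zero)
      linarith
  refine ⟨L / 2 / (m / 2) + (b + b * K₂ + B * (1 + K₂)) * (1 + a) / c
    + (b + b * K₂ + B * (1 + K₂)) / d, fun β hβ lam hlam => ?_⟩
  have hβ0 : 0 < β := hK₁.trans_le hβ.1
  have hβI : β ∈ Set.Icc a N := ⟨by linarith [hβ.1], by linarith [hβ.2]⟩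
  have hJ_quad : ∀ x ∈ Set.Icc a N, m / 2 * (x - β) ^ 2 ≤ Jfun g Φ β x := fun x hx => by
    have := half_mul_sq_le_sub_of_le_deriv2 (convex_Icc a N) (fun x hx => hJ' β hβ0 x (hsub hx))
      (fun x hx => hJ'' β x (hsub hx)) hmle hβI hx
    rwa [hJβ β hβ0, sub_zero, sub_self, zero_mul, sub_zero] at this
  refine abs_le_mul_of_three_regimes (β := β) (N := N) (half_pos hm) hc0 hd0 (by positivity)
    (by positivity) ha.le hlam (fun hla => ?_) (fun hal hlN => ⟨?_, hJ_quad lam ⟨hal, hlN⟩⟩)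
    (fun hlN => ?_) ?_
  · rcases hlam.eq_or_lt with rfl | hlam0
    · refine (min_le_right _ _).trans ?_
      have hZ0 : partZ g (Φ 0) = 1 := by
        rw [hΦ0, partZ, tsum_eq_single 0 fun k hk => by simp [hk]]
        simp [gFact]
      rw [Jfun, hZ0, zero_mul, zero_sub, one_div, Real.log_inv, neg_neg]
      refine Real.log_le_log (by have := hpos K₁ hK₁; have := hg 1 one_ne_zero; positivity) ?_
      refine le_trans ?_ (one_add_div_le_partZ hg (hpos β hβ0).le (hsum β hβ0.le))
      have := hmono.monotoneOn hK₁.le hβ0.le hβ.1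
      have := hg 1 one_ne_zero
      gcongr
    · refine (min_le_left _ _).trans ?_
      have h1 := hJ_quad a ⟨le_rfl, hne.some_mem.1.trans hne.some_mem.2⟩
      have h2 := hJ_tangent β hβ0 lam hlam0 a ha
      have h3 : Real.log (Φ a) ≤ Real.log (Φ β) :=
        Real.log_le_log (hpos a ha) (hmono.monotoneOn ha.le hβ0.le hβI.1)
      have h4 : m / 2 * (K₁ - a) ^ 2 ≤ m / 2 * (a - β) ^ 2 := by
        have := hβ.1
        gcongr ?_ * ?_
        nlinarith
      have h5 := mul_nonneg_of_nonpos_of_nonpos (sub_nonpos.2 h3) (sub_nonpos.2 hla.le)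
      linarith
  · have hbd : ∀ x ∈ Set.Icc a N, |2 * Φ' x * Φ' x + 2 * Φ x * Φ'' x| ≤ L := hL
    have h1 := half_mul_sq_le_sub_of_le_deriv2 (convex_Icc a N) hp' hp''
      (fun x hx => (abs_le.1 (hbd x hx)).1) hβI ⟨hal, hlN⟩
    have h2 := half_mul_sq_le_sub_of_le_deriv2 (convex_Icc a N) (fun x hx => (hp' x hx).neg)
      (fun x hx => (hp'' x hx).neg) (fun x hx => neg_le_neg (abs_le.1 (hbd x hx)).2) hβI ⟨hal, hlN⟩
    simp only [Pi.neg_apply] at h2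
    rw [Mfun, abs_le]
    constructor <;> linarith
  · have h1 := hJ_quad N ⟨by linarith, le_rfl⟩
    have h2 := hJ_tangent β hβ0 lam (by linarith) N hN0
    have h3 : δ ≤ Real.log (Φ N) - Real.log (Φ β) := sub_le_sub_left
      (Real.log_le_log (hpos β hβ0) (hmono.monotoneOn hβ0.le hK₂.le hβ.2)) _
    have h4 : d * (1 + N) ≤ m / 2 := by
      have := min_le_left (m / 2 / (1 + N)) δ
      rwa [le_div_iff₀ (by positivity)] at this
    have h5 : d * (lam - N) ≤ (Real.log (Φ N) - Real.log (Φ β)) * (lam - N) :=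
      mul_le_mul_of_nonneg_right ((min_le_right _ _).trans h3) (by linarith)
    have h6 : m / 2 * 1 ≤ m / 2 * (N - β) ^ 2 := by
      have := hβ.2
      gcongr
      nlinarith
    linarith
  · have h1 := hsq lam hlam
    have h2 := hsq β hβ0.le
    have h3 : |2 * Φ β * Φ' β| ≤ B := hB β hβI
    have h4 : |lam - β| ≤ lam + K₂ := abs_le.2 ⟨by linarith [hβ.2], by linarith [hβ.2]⟩
    have h5 : |2 * Φ β * Φ' β * (lam - β)| ≤ B * (lam + K₂) := by
      rw [abs_mul]
      gcongr
    have h6 : b * β ≤ b * K₂ := by have := hβ.2; gcongr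
    have h7 := abs_le.1 h5
    have h8 : b * lam + b * K₂ + B * (lam + K₂) ≤ (b + b * K₂ + B * (1 + K₂)) * (1 + lam) := by
      have : 0 ≤ b + b * K₂ * lam + B + B * K₂ * lam := by positivity
      linarith
    refine le_trans (abs_le.2 ⟨?_, ?_⟩) h8 <;> rw [Mfun] <;>
      nlinarith [sq_nonneg (Φ lam), sq_nonneg (Φ β), mul_nonneg hb.le hlam]
end
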